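/- Suppose δ = 0 (so θ_min = π/(2g)), and define φ(θ) = A2(θ) − H2(θ)/n for θ ∈ (0, π/g). Then for every ε with 0 < ε < 1 there exists c₀ > 0 such that for every differentiable θ : (−∞, 0] → (0, π/g) satisfying θ'(t) = −n·(cot(gθ(t)) + δ·csc(gθ(t))) with |θ(0) − π/(2g)| < c₀, one has (g − 1)·n ≤ φ(θ(t)) ≤ (g − 1 + ε)·n for all t ≤ 0. -/

import Mathlib

open Real

/-- `n = g(m₁+m₂)/2`, the dimension of the isoparametric hypersurface. -/
noncomputable def nn (g m₁ m₂ : ℕ) : ℝ := (g : ℝ) * ((m₁ : ℝ) + (m₂ : ℝ)) / 2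

/-- `δ = (m₂ − m₁)/(m₁ + m₂)`. -/
noncomputable def dlt (m₁ m₂ : ℕ) : ℝ := ((m₂ : ℝ) - (m₁ : ℝ)) / ((m₁ : ℝ) + (m₂ : ℝ))

/-- The right-hand side of the spherical MCF ODE: `−n(cot gθ + δ csc gθ)`. -/
noncomputable def sphODE (g m₁ m₂ : ℕ) (θ : ℝ) : ℝ :=
  -(nn g m₁ m₂) * (Real.cos ((g : ℝ) * θ) / Real.sin ((g : ℝ) * θ)
    + dlt m₁ m₂ * (1 / Real.sin ((g : ℝ) * θ)))

/-- `A2(θ) = ng(1 + δ cos gθ)/sin²(gθ) − n`, the squared norm of the spherical shape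
operator of the isoparametric hypersurface at angle `θ`. -/
noncomputable def A2 (g m₁ m₂ : ℕ) (θ : ℝ) : ℝ :=
  nn g m₁ m₂ * (g : ℝ) * (1 + dlt m₁ m₂ * Real.cos ((g : ℝ) * θ)) /
    (Real.sin ((g : ℝ) * θ)) ^ 2 - nn g m₁ m₂

/-- `H2(θ) = n²(cos gθ + δ)²/sin²(gθ)`, the squared norm of the spherical mean
curvature of the isoparametric hypersurface at angle `θ`. -/
noncomputable def H2 (g m₁ m₂ : ℕ) (θ : ℝ) : ℝ :=
  (nn g m₁ m₂) ^ 2 * (Real.cos ((g : ℝ) * θ) + dlt m₁ m₂) ^ 2 /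
    (Real.sin ((g : ℝ) * θ)) ^ 2

theorem nn_pos {g m₁ m₂ : ℕ} (hg : 1 ≤ g) (hm₁ : 0 < m₁) : 0 < nn g m₁ m₂ := by
  have : (0 : ℝ) < g := by exact_mod_cast hg
  have : (0 : ℝ) < m₁ := by exact_mod_cast hm₁
  unfold nn
  positivity

theorem sin_mul_pos_of_mem_Ioo {g : ℕ} (hg : 1 ≤ g) {x : ℝ}
    (hx : x ∈ Set.Ioo 0 (π / (g : ℝ))) : 0 < sin ((g : ℝ) * x) := by
  have hg0 : (0 : ℝ) < g := by exact_mod_cast hg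
  refine sin_pos_of_pos_of_lt_pi (mul_pos hg0 hx.1) ?_
  rw [mul_comm]
  exact (lt_div_iff₀ hg0).1 hx.2

/-- For `δ = 0`, the squared norm of the traceless second fundamental form is
`(g − 1)n / sin²(gθ)`. -/
theorem A2_sub_H2_div_nn {g m₁ m₂ : ℕ} (hn : nn g m₁ m₂ ≠ 0) (hδ : dlt m₁ m₂ = 0) {x : ℝ}
    (hs : sin ((g : ℝ) * x) ≠ 0) :
    A2 g m₁ m₂ x - H2 g m₁ m₂ x / nn g m₁ m₂ =
      ((g : ℝ) - 1) * nn g m₁ m₂ / sin ((g : ℝ) * x) ^ 2 := by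
  unfold A2 H2
  rw [hδ]
  field_simp
  linear_combination (-1 : ℝ) * sin_sq_add_cos_sq ((g : ℝ) * x)

/-- For `δ = 0`, the function `u = cos(gθ)` satisfies `u' = ngu` along the flow. -/
theorem hasDerivAt_cos_mul {g m₁ m₂ : ℕ} (hδ : dlt m₁ m₂ = 0) {θ : ℝ → ℝ} {t : ℝ}
    (hs : sin ((g : ℝ) * θ t) ≠ 0) (h : HasDerivAt θ (sphODE g m₁ m₂ (θ t)) t) :
    HasDerivAt (fun s => cos ((g : ℝ) * θ s))
      (nn g m₁ m₂ * (g : ℝ) * cos ((g : ℝ) * θ t)) t := by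
  convert (h.const_mul (g : ℝ)).cos using 1
  unfold sphODE
  rw [hδ]
  field_simp
  ring

/-- For `δ = 0`, `cos²(gθ)` is nondecreasing along the ancient flow. -/
theorem monotoneOn_cos_sq {g m₁ m₂ : ℕ} (hg : 1 ≤ g) (hm₁ : 0 < m₁) (hδ : dlt m₁ m₂ = 0)
    {θ : ℝ → ℝ} (h : ∀ t ≤ (0 : ℝ), θ t ∈ Set.Ioo 0 (π / (g : ℝ)) ∧
      HasDerivAt θ (sphODE g m₁ m₂ (θ t)) t) :
    MonotoneOn (fun t => cos ((g : ℝ) * θ t) ^ 2) (Set.Iic 0) := by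
  have hd : ∀ t ≤ (0 : ℝ), HasDerivAt (fun t => cos ((g : ℝ) * θ t) ^ 2)
      (2 * nn g m₁ m₂ * (g : ℝ) * cos ((g : ℝ) * θ t) ^ 2) t := by
    intro t ht
    obtain ⟨hmem, hder⟩ := h t ht
    refine ((hasDerivAt_cos_mul hδ
      (sin_mul_pos_of_mem_Ioo hg hmem).ne' hder).fun_pow 2).congr_deriv ?_
    push_cast
    ring
  refine monotoneOn_of_deriv_nonneg (convex_Iic 0)
    (fun t ht => (hd t ht).continuousAt.continuousWithinAt)
    (fun t ht => (hd t (Set.mem_Iic.1 (interior_subset ht))).differentiableAt.differentiableWithinAt)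
    (fun t ht => ?_)
  rw [(hd t (Set.mem_Iic.1 (interior_subset ht))).deriv]
  have := nn_pos (m₂ := m₂) hg hm₁
  positivity

/-- `|cos(gx)|` is bounded by `g` times the distance from `x` to `π/(2g)`. -/
theorem abs_cos_mul_le {g : ℕ} (hg : 1 ≤ g) (x : ℝ) :
    |cos ((g : ℝ) * x)| ≤ (g : ℝ) * |x - π / (2 * (g : ℝ))| := by
  have hg0 : (0 : ℝ) < g := by exact_mod_cast hg
  have e : π / 2 - (g : ℝ) * x = -((g : ℝ) * (x - π / (2 * (g : ℝ)))) := by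
    field_simp
    ring
  rw [← sin_pi_div_two_sub, e]
  refine abs_sin_le_abs.trans_eq ?_
  rw [abs_neg, abs_mul, abs_of_pos hg0]

/-- Proposition 4.17(1): if `δ = 0`, then for every `0 < ε < 1` there is `c₀ > 0` such
that any ancient spherical MCF of isoparametric hypersurfaces starting with
`|θ(0) − π/(2g)| < c₀` satisfies `(g−1)n ≤ φ(θ(t)) ≤ (g−1+ε)n` for all `t ≤ 0`,
where `φ(θ) = ‖A‖² − ‖H‖²/n` is the squared norm of the traceless second fundamental
form. -/
theorem traceless_estimate_delta_zero (g m₁ m₂ : ℕ) (hg : 1 ≤ g)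
    (hm₁ : 0 < m₁) (hm₂ : 0 < m₂) (hodd : Odd g → m₁ = m₂)
    (hδ : dlt m₁ m₂ = 0) :
    ∀ ε : ℝ, 0 < ε → ε < 1 →
      ∃ c₀ > (0 : ℝ), ∀ θ : ℝ → ℝ,
        (∀ t ≤ (0 : ℝ), θ t ∈ Set.Ioo 0 (π / (g : ℝ)) ∧
          HasDerivAt θ (sphODE g m₁ m₂ (θ t)) t) →
        |θ 0 - π / (2 * (g : ℝ))| < c₀ →
        ∀ t ≤ (0 : ℝ),
          ((g : ℝ) - 1) * nn g m₁ m₂ ≤ A2 g m₁ m₂ (θ t) - H2 g m₁ m₂ (θ t) / nn g m₁ m₂ ∧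
          A2 g m₁ m₂ (θ t) - H2 g m₁ m₂ (θ t) / nn g m₁ m₂
            ≤ ((g : ℝ) - 1 + ε) * nn g m₁ m₂ := by
  intro ε hε hε1
  have hg1 : (1 : ℝ) ≤ g := by exact_mod_cast hg
  have hg0 : (0 : ℝ) < g := by linarith
  have hn := nn_pos (m₂ := m₂) hg hm₁
  refine ⟨ε / (g : ℝ) ^ 2, by positivity, fun θ h h0 t ht => ?_⟩
  have hs := sin_mul_pos_of_mem_Ioo hg (h t ht).1
  rw [A2_sub_H2_div_nn hn.ne' hδ hs.ne']
  have hmono : cos ((g : ℝ) * θ t) ^ 2 ≤ cos ((g : ℝ) * θ 0) ^ 2 :=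
    monotoneOn_cos_sq hg hm₁ hδ h ht (Set.mem_Iic.2 le_rfl) ht
  have hcos : |cos ((g : ℝ) * θ 0)| ≤ ε / g := by
    calc |cos ((g : ℝ) * θ 0)| ≤ (g : ℝ) * |θ 0 - π / (2 * (g : ℝ))| := abs_cos_mul_le hg _
      _ ≤ (g : ℝ) * (ε / (g : ℝ) ^ 2) := by gcongr
      _ = ε / g := by field_simp
  have hdiv : ε / g ≤ 1 := (div_le_one hg0).2 (by linarith)
  have hsq : cos ((g : ℝ) * θ t) ^ 2 ≤ ε / g := by
    rw [← sq_abs (cos ((g : ℝ) * θ 0))] at hmono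
    nlinarith [abs_nonneg (cos ((g : ℝ) * θ 0))]
  have hgc : (g : ℝ) * cos ((g : ℝ) * θ t) ^ 2 ≤ ε := by
    rwa [le_div_iff₀' hg0] at hsq
  have hsc := sin_sq_add_cos_sq ((g : ℝ) * θ t)
  have hgn : 0 ≤ ((g : ℝ) - 1) * nn g m₁ m₂ := mul_nonneg (by linarith) hn.le
  constructor
  · rw [le_div_iff₀ (by positivity)]
    exact mul_le_of_le_one_right hgn (sin_sq_le_one _)
  · rw [div_le_iff₀ (by positivity), mul_right_comm]
    refine mul_le_mul_of_nonneg_right ?_ hn.le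
    nlinarith [sq_nonneg (cos ((g : ℝ) * θ t))]
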